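/- For every positive integer N, every integer k ≥ 3, and every integer d ≥ k, there exist unit vectors ψ_1, …, ψ_k in ℂ^d with equal real pairwise inner products (⟨ψ_i, ψ_j⟩ = γ for all i ≠ j, for some real γ ∈ (0,1)) such that the family {ψ_1, …, ψ_k} is not antidistinguishable with N copies but is antidistinguishable with N+1 copies; in particular, the family is (N+1)-copy antidistinguishable. -/

import Mathlib

namespace QSE

noncomputable section

open scoped ComplexOrder

/-- The standard Hermitian inner product `⟨ψ, φ⟩ = ∑ a, conj (ψ a) * φ a` on `I → ℂ`. -/
def inp {I : Type} [Fintype I] (ψ φ : I → ℂ) : ℂ :=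
  ∑ a, (starRingEnd ℂ) (ψ a) * φ a

/-- A family of pure states `ψ 1, …, ψ k` (vectors in a complex Euclidean space indexed by `I`)
is antidistinguishable if there is a POVM `P 1, …, P k` (positive semidefinite matrices summing
to the identity) such that `⟨ψ j, P j ψ j⟩ = 0` for every `j`, and for every `j` there is some
`i` with `⟨ψ i, P j ψ i⟩ ≠ 0`. -/
def Antidistinguishable {I : Type} [Fintype I] [DecidableEq I] {k : ℕ}
    (ψ : Fin k → I → ℂ) : Prop :=
  ∃ P : Fin k → Matrix I I ℂ,
    (∀ j, (P j).PosSemidef) ∧ (∑ j, P j) = 1 ∧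
    (∀ j, inp (ψ j) ((P j).mulVec (ψ j)) = 0) ∧
    (∀ j, ∃ i, inp (ψ i) ((P j).mulVec (ψ i)) ≠ 0)

/-- The concretely realized `N`-th tensor power of `ψ : Fin d → ℂ`: the vector indexed by
functions `f : Fin N → Fin d` whose component at `f` is `∏ t, ψ (f t)`. -/
def tpow {d : ℕ} (ψ : Fin d → ℂ) (N : ℕ) : (Fin N → Fin d) → ℂ :=
  fun f => ∏ t, ψ (f t)

/-- The family `ψ` is antidistinguishable with `N` copies if the family of `N`-th tensor
powers is antidistinguishable. -/
def AntidistinguishableN {d k : ℕ} (ψ : Fin k → Fin d → ℂ) (N : ℕ) : Prop :=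
  Antidistinguishable (fun i => tpow (ψ i) N)

/-- The family `ψ` is `N`-copy antidistinguishable if it is antidistinguishable with `N`
copies but not with any smaller positive number of copies. -/
def NCopyAntidistinguishable {d k : ℕ} (ψ : Fin k → Fin d → ℂ) (N : ℕ) : Prop :=
  AntidistinguishableN ψ N ∧
  ∀ N' : ℕ, 0 < N' → N' < N → ¬ AntidistinguishableN ψ N'

lemma inp_eq_dotProduct {I : Type} [Fintype I] (ψ φ : I → ℂ) : inp ψ φ = star ψ ⬝ᵥ φ := rfl

lemma inp_tpow {d : ℕ} (ψ φ : Fin d → ℂ) (N : ℕ) :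
    inp (tpow ψ N) (tpow φ N) = inp ψ φ ^ N := by
  simp only [inp, tpow, map_prod, ← Finset.prod_mul_distrib]
  exact (Fintype.sum_pow (fun a => (starRingEnd ℂ) (ψ a) * φ a) N).symm

/-- If the sesquilinear forms of positive semidefinite matrices are tabulated by `B l i j`, with
total Gram matrix of constant off-diagonal entry `g`, then `g ≤ (k - 2) / (k - 1)`. -/
lemma gram_bound {k : ℕ} (hk : 0 < k) {B : Fin k → Fin k → Fin k → ℝ} {g : ℝ}
    (hsum : ∀ i j, ∑ l, B l i j = if i = j then 1 else g)
    (hleft : ∀ l j, B l l j = 0) (hright : ∀ l i, B l i l = 0)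
    (hpos : ∀ l i j, B l i j + B l j i ≤ B l i i + B l j j) :
    g * (k - 1) ≤ k - 2 := by
  have hpt : ∀ l i j, B l i j + B l j i ≤
      (if j = l then 0 else B l i i) + (if i = l then 0 else B l j j) := by
    intro l i j
    by_cases hj : j = l
    · subst hj; by_cases hi : i = j <;> simp [hleft, hright]
    · by_cases hi : i = l
      · subst hi; simp [hleft, hright]
      · simpa [hi, hj] using hpos l i j
  have hS := Finset.sum_le_sum fun i (_ : i ∈ Finset.univ) =>
    Finset.sum_le_sum fun j (_ : j ∈ Finset.univ) =>
      Finset.sum_le_sum fun l (_ : l ∈ Finset.univ) => hpt l i j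
  have hA : ∑ i : Fin k, ∑ j : Fin k, ∑ l : Fin k, B l i j = k + k * (k - 1) * g := by
    simp only [hsum]
    have : ∀ i j : Fin k, (if i = j then (1 : ℝ) else g) = g + if i = j then 1 - g else 0 := by
      intro i j; split_ifs <;> ring
    simp only [this, Finset.sum_add_distrib, Finset.sum_ite_eq, Finset.mem_univ, if_true,
      Finset.sum_const, Finset.card_univ, Fintype.card_fin, nsmul_eq_mul]
    ring
  have hA' : ∑ i : Fin k, ∑ j : Fin k, ∑ l : Fin k, B l j i = k + k * (k - 1) * g := by
    rw [Finset.sum_comm]; exact hA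
  have hC : ∑ i : Fin k, ∑ j : Fin k, ∑ l : Fin k, (if j = l then 0 else B l i i)
      = (k - 1) * k := by
    have h1 : ∀ i : Fin k, ∑ j : Fin k, ∑ l : Fin k, (if j = l then 0 else B l i i)
        = k - 1 := by
      intro i
      have h2 : ∀ j l : Fin k, (if j = l then 0 else B l i i)
          = B l i i - if j = l then B l i i else 0 := by
        intro j l; split_ifs <;> ring
      simp [h2, Finset.sum_sub_distrib, hsum]
    simp only [h1, Finset.sum_const, Finset.card_univ, Fintype.card_fin, nsmul_eq_mul]
    ring
  have hC' : ∑ i : Fin k, ∑ j : Fin k, ∑ l : Fin k, (if i = l then 0 else B l j j)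
      = (k - 1) * k := by
    rw [Finset.sum_comm]; exact hC
  simp only [Finset.sum_add_distrib] at hS
  rw [hA, hA', hC, hC'] at hS
  have hk' : (0 : ℝ) < k := by exact_mod_cast hk
  refine le_of_mul_le_mul_left ?_ hk'
  linarith

lemma Antidistinguishable.inner_bound {I : Type} [Fintype I] [DecidableEq I] {k : ℕ}
    (hk : 0 < k) {φ : Fin k → I → ℂ} {g : ℝ} (hφ : Antidistinguishable φ)
    (hgram : ∀ i j, inp (φ i) (φ j) = if i = j then 1 else (g : ℂ)) :
    g * (k - 1) ≤ k - 2 := by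
  obtain ⟨P, hP, hP1, hP0, -⟩ := hφ
  have hker : ∀ l, (P l).mulVec (φ l) = 0 := fun l =>
    ((hP l).dotProduct_mulVec_zero_iff (φ l)).1 (hP0 l)
  refine gram_bound hk (B := fun l i j => (star (φ i) ⬝ᵥ (P l).mulVec (φ j)).re) ?_ ?_ ?_ ?_
  · intro i j
    rw [← Complex.re_sum, ← dotProduct_sum, ← Matrix.sum_mulVec, hP1, Matrix.one_mulVec,
      ← inp_eq_dotProduct, hgram]
    split_ifs <;> simp
  · intro l j
    have h : star (φ l) ⬝ᵥ (P l).mulVec (φ j) = star ((P l).mulVec (φ l)) ⬝ᵥ φ j := by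
      rw [Matrix.star_mulVec, (hP l).1.eq, Matrix.dotProduct_mulVec]
    simp [h, hker]
  · intro l i
    simp [hker]
  · intro l i j
    have h := (Complex.le_def.1 ((hP l).dotProduct_mulVec_nonneg (φ i - φ j))).1
    simp only [star_sub, Matrix.mulVec_sub, sub_dotProduct, dotProduct_sub, Complex.sub_re,
      Complex.zero_re] at h
    linarith

/-- An orthonormal system `e` with `e l` orthogonal to `φ i` exactly when `i = l`, and whose span
contains every `φ i`, gives an antidistinguishing measurement. -/
lemma antidistinguishable_of_orthonormal {I : Type} [Fintype I] [DecidableEq I] {k : ℕ}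
    (hk : 2 ≤ k) {φ e : Fin k → I → ℂ}
    (he : ∀ i j, inp (e i) (e j) = if i = j then 1 else 0)
    (hself : ∀ i, inp (e i) (φ i) = 0)
    (hne : ∀ i j, i ≠ j → inp (e i) (φ j) ≠ 0)
    (hspan : ∀ i, ∑ l, inp (e l) (φ i) • e l = φ i) :
    Antidistinguishable φ := by
  have hproj : ∀ l v, (Matrix.vecMulVec (e l) (star (e l))).mulVec v = inp (e l) v • e l := by
    intro l v
    rw [Matrix.vecMulVec_mulVec, inp_eq_dotProduct]
    ext x; simp [mul_comm]
  set R : Matrix I I ℂ := ∑ l, Matrix.vecMulVec (e l) (star (e l)) with hR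
  have hRherm : R.conjTranspose = R := by
    simp [hR, Matrix.conjTranspose_sum, Matrix.conjTranspose_vecMulVec]
  have hRR : R * R = R := by
    simp only [hR, Finset.sum_mul_sum, Matrix.vecMulVec_mul_vecMulVec]
    simp only [← inp_eq_dotProduct, he, ite_smul, one_smul, zero_smul]
    refine Finset.sum_congr rfl fun i _ => ?_
    rw [Finset.sum_eq_single i (fun j _ hj => by simp [hj.symm]) (by simp), if_pos rfl]
  have hQ : (1 - R).PosSemidef := by
    have : 1 - R = (1 - R).conjTranspose * (1 - R) := by
      rw [Matrix.conjTranspose_sub, Matrix.conjTranspose_one, hRherm]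
      simp [mul_sub, sub_mul, hRR]
    rw [this]
    exact Matrix.posSemidef_conjTranspose_mul_self _
  have hRφ : ∀ i, (1 - R).mulVec (φ i) = 0 := by
    intro i
    simp [Matrix.sub_mulVec, hR, Matrix.sum_mulVec, hproj, hspan]
  have hform : ∀ (j i : Fin k),
      (Matrix.vecMulVec (e j) (star (e j)) + if j = ⟨0, by omega⟩ then 1 - R else 0).mulVec (φ i)
        = inp (e j) (φ i) • e j := by
    intro j i
    split_ifs <;> simp [Matrix.add_mulVec, hproj, hRφ]
  refine ⟨fun j => Matrix.vecMulVec (e j) (star (e j)) +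
    if j = ⟨0, by omega⟩ then 1 - R else 0, ?_, ?_, ?_, ?_⟩
  · intro j
    refine (Matrix.posSemidef_vecMulVec_self_star (e j)).add ?_
    split_ifs
    exacts [hQ, Matrix.PosSemidef.zero]
  · simp [Finset.sum_add_distrib, ← hR]
  · intro j
    rw [hform, hself]
    simp [inp]
  · intro j
    have : Nontrivial (Fin k) := Fin.nontrivial_iff_two_le.2 hk
    obtain ⟨i, hi⟩ := exists_ne j
    refine ⟨i, ?_⟩
    rw [hform, inp_eq_dotProduct, dotProduct_smul, smul_eq_mul]
    refine mul_ne_zero (hne j i hi.symm) ?_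
    have h : star (φ i) ⬝ᵥ e j = star (star (e j) ⬝ᵥ φ i) := by
      rw [Matrix.star_dotProduct]
    rw [h, star_ne_zero]
    exact hne j i hi.symm

lemma antidistinguishable_of_gram {I : Type} [Fintype I] [DecidableEq I] {k : ℕ}
    (hk : 3 ≤ k) {φ : Fin k → I → ℂ} {g : ℝ} (hg : g * (k - 1) = k - 2)
    (hgram : ∀ i j, inp (φ i) (φ j) = if i = j then 1 else (g : ℂ)) :
    Antidistinguishable φ := by
  have hk' : (3 : ℝ) ≤ k := by exact_mod_cast hk
  obtain ⟨r, hr0, hr2⟩ : ∃ r : ℝ, 0 < r ∧ r ^ 2 = k - 1 :=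
    ⟨√(k - 1), Real.sqrt_pos.2 (by linarith), Real.sq_sqrt (by linarith)⟩
  have hrC : (r : ℂ) ≠ 0 := by exact_mod_cast hr0.ne'
  have hr2C : (r : ℂ) ^ 2 = k - 1 := by exact_mod_cast hr2
  have hkC : (k : ℂ) = r ^ 2 + 1 := by rw [hr2C]; ring
  have hgC : (g : ℂ) * r ^ 2 = r ^ 2 - 1 := by
    rw [hr2C]
    have : (g : ℂ) * (k - 1) = k - 2 := by exact_mod_cast hg
    rw [this]; ring
  have hgram' : ∀ i j, star (φ i) ⬝ᵥ φ j = (g : ℂ) + if i = j then 1 - (g : ℂ) else 0 := by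
    intro i j
    rw [← inp_eq_dotProduct, hgram]
    split_ifs <;> ring
  set s : I → ℂ := ∑ i, φ i with hs
  have hsφ : ∀ j, star s ⬝ᵥ φ j = (r : ℂ) ^ 2 := by
    intro j
    simp only [hs, star_sum, sum_dotProduct, hgram', Finset.sum_add_distrib,
      Finset.sum_ite_eq', Finset.mem_univ, if_true, Finset.sum_const, Finset.card_univ,
      Fintype.card_fin, nsmul_eq_mul]
    rw [hkC]; linear_combination hgC
  have hφs : ∀ j, star (φ j) ⬝ᵥ s = (r : ℂ) ^ 2 := by
    intro j
    simp only [hs, dotProduct_sum, hgram', Finset.sum_add_distrib,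
      Finset.sum_ite_eq, Finset.mem_univ, if_true, Finset.sum_const, Finset.card_univ,
      Fintype.card_fin, nsmul_eq_mul]
    rw [hkC]; linear_combination hgC
  have hss : star s ⬝ᵥ s = ((r : ℂ) ^ 2 + 1) * r ^ 2 := by
    conv_lhs => rw [hs, dotProduct_sum, ← hs]
    simp [hsφ, hkC]
  have heφ : ∀ i j, inp ((r : ℂ)⁻¹ • s - (r : ℂ) • φ i) (φ j)
      = if i = j then 0 else (r : ℂ)⁻¹ := by
    intro i j
    rw [inp_eq_dotProduct]
    simp only [star_sub, star_smul, sub_dotProduct, smul_dotProduct, hsφ, hgram', smul_eq_mul,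
      star_inv₀, Complex.star_def, Complex.conj_ofReal]
    split_ifs <;> field_simp
    · ring
    · linear_combination -hgC
  refine antidistinguishable_of_orthonormal (by omega)
    (e := fun i => (r : ℂ)⁻¹ • s - (r : ℂ) • φ i) ?_ ?_ ?_ ?_
  · intro i j
    rw [inp_eq_dotProduct]
    simp only [star_sub, star_smul, sub_dotProduct, dotProduct_sub, smul_dotProduct,
      dotProduct_smul, hsφ, hφs, hss, hgram', smul_eq_mul,
      star_inv₀, Complex.star_def, Complex.conj_ofReal]
    split_ifs <;> field_simp
    · ring
    · linear_combination hgC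
  · exact fun i => (heφ i i).trans (if_pos rfl)
  · exact fun i j hij => by rw [heφ, if_neg hij]; exact inv_ne_zero hrC
  · intro i
    have h : ∀ l, (if l = i then (0 : ℂ) else (r : ℂ)⁻¹) =
        (r : ℂ)⁻¹ - if l = i then (r : ℂ)⁻¹ else 0 := by
      intro l; split_ifs <;> ring
    simp only [heφ, h, sub_smul, Finset.sum_sub_distrib, ite_smul, zero_smul,
      Finset.sum_ite_eq', Finset.mem_univ, if_true, ← Finset.smul_sum, Finset.sum_const,
      Finset.card_univ, Fintype.card_fin, ← hs]
    ext x
    simp only [Pi.sub_apply, Pi.smul_apply, smul_eq_mul, nsmul_eq_mul, Pi.mul_apply,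
      Pi.natCast_apply, hkC]
    field_simp
    ring

lemma exists_equiangular {k d : ℕ} (hd0 : 0 < d) (hd : k ≤ d) {γ : ℝ} (h0 : 0 ≤ γ) (h1 : γ ≤ 1) :
    ∃ ψ : Fin k → Fin d → ℂ, ∀ i j, inp (ψ i) (ψ j) = if i = j then 1 else (γ : ℂ) := by
  have hdR : (0 : ℝ) < d := by exact_mod_cast hd0
  obtain ⟨a, ha⟩ : ∃ a : ℝ, a ^ 2 = 1 - γ := ⟨√(1 - γ), Real.sq_sqrt (by linarith)⟩
  obtain ⟨b, hb⟩ : ∃ b : ℝ, 2 * a * b + d * b ^ 2 = γ := by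
    refine ⟨(√(a ^ 2 + d * γ) - a) / d, ?_⟩
    have h := Real.sq_sqrt (show 0 ≤ a ^ 2 + d * γ by positivity)
    field_simp
    linear_combination h
  have haC : (a : ℂ) ^ 2 = 1 - γ := by exact_mod_cast ha
  have hbC : 2 * (a : ℂ) * b + d * b ^ 2 = γ := by exact_mod_cast hb
  refine ⟨fun i x => (if Fin.castLE hd i = x then (a : ℂ) else 0) + b, fun i j => ?_⟩
  have hterm : ∀ x : Fin d,
      (starRingEnd ℂ) ((if Fin.castLE hd i = x then (a : ℂ) else 0) + b) *
        ((if Fin.castLE hd j = x then (a : ℂ) else 0) + b) =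
      (if Fin.castLE hd i = x then (if i = j then (a : ℂ) ^ 2 else 0) else 0) +
        (if Fin.castLE hd i = x then (a : ℂ) * b else 0) +
        (if Fin.castLE hd j = x then (a : ℂ) * b else 0) + (b : ℂ) ^ 2 := by
    intro x
    have hinj : i = j ↔ Fin.castLE hd i = Fin.castLE hd j := (Fin.castLE_inj).symm
    rw [map_add, apply_ite (starRingEnd ℂ), map_zero, Complex.conj_ofReal, Complex.conj_ofReal]
    by_cases hi : Fin.castLE hd i = x <;> by_cases hj : Fin.castLE hd j = x
    · rw [if_pos hi, if_pos hj, if_pos hi, if_pos (hinj.2 (hi.trans hj.symm)), if_pos hi,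
        if_pos hj]
      ring
    · rw [if_pos hi, if_neg hj, if_pos hi, if_neg (fun h => hj ((hinj.1 h).symm.trans hi)),
        if_pos hi, if_neg hj]
      ring
    · simp only [if_neg hi, if_pos hj]
      ring
    · simp only [if_neg hi, if_neg hj]
      ring
  simp only [inp, hterm, Finset.sum_add_distrib, Finset.sum_ite_eq, Finset.mem_univ, if_true,
    Finset.sum_const, Finset.card_univ, Fintype.card_fin, nsmul_eq_mul]
  split_ifs
  · linear_combination haC + hbC
  · linear_combination hbC

/-- For every positive `N`, every `k ≥ 3`, and every `d ≥ k`, there exist `k` unit vectors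
in `ℂ^d` with equal real pairwise inner products `γ ∈ (0, 1)` that are not
antidistinguishable with `N` copies but are antidistinguishable with `N + 1` copies; in
particular, the family is `(N+1)`-copy antidistinguishable. -/
theorem stmt16 (N k d : ℕ) (hN : 0 < N) (hk : 3 ≤ k) (hd : k ≤ d) :
    ∃ ψ : Fin k → Fin d → ℂ, ∃ γ : ℝ,
      (∀ i, inp (ψ i) (ψ i) = 1) ∧
      0 < γ ∧ γ < 1 ∧
      (∀ i j, i ≠ j → inp (ψ i) (ψ j) = (γ : ℂ)) ∧
      ¬ AntidistinguishableN ψ N ∧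
      AntidistinguishableN ψ (N + 1) ∧
      NCopyAntidistinguishable ψ (N + 1) := by
  have hk' : (3 : ℝ) ≤ k := by exact_mod_cast hk
  obtain ⟨q, hq⟩ : ∃ q : ℝ, q = (k - 2) / (k - 1) := ⟨_, rfl⟩
  have hq0 : 0 < q := hq ▸ div_pos (by linarith) (by linarith)
  have hq1 : q < 1 := by rw [hq, div_lt_one (by linarith)]; linarith
  have hqk : q * (k - 1) = k - 2 := by
    rw [hq, div_mul_cancel₀]
    linarith
  obtain ⟨γ, hγ⟩ : ∃ γ : ℝ, γ = q ^ (((N + 1 : ℕ) : ℝ)⁻¹) := ⟨_, rfl⟩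
  have hγ0 : 0 < γ := hγ ▸ Real.rpow_pos_of_pos hq0 _
  have hγ1 : γ < 1 := hγ ▸ Real.rpow_lt_one hq0.le hq1 (by positivity)
  have hγN : γ ^ (N + 1) = q := by
    rw [hγ, Real.rpow_inv_natCast_pow hq0.le (Nat.succ_ne_zero N)]
  obtain ⟨ψ, hψ⟩ := exists_equiangular (k := k) (by omega) hd hγ0.le hγ1.le
  have hgram : ∀ M i j, inp (tpow (ψ i) M) (tpow (ψ j) M)
      = if i = j then 1 else ((γ ^ M : ℝ) : ℂ) := by
    intro M i j
    rw [inp_tpow, hψ]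
    split_ifs <;> simp
  have hnot : ∀ M, M < N + 1 → ¬ AntidistinguishableN ψ M := by
    intro M hM h
    have hb := Antidistinguishable.inner_bound (by omega) h (hgram M)
    have hlt : q < γ ^ M := hγN ▸ pow_lt_pow_right_of_lt_one₀ hγ0 hγ1 hM
    have := mul_lt_mul_of_pos_right hlt (show (0 : ℝ) < k - 1 by linarith)
    linarith
  have hyes : AntidistinguishableN ψ (N + 1) :=
    antidistinguishable_of_gram hk (hγN ▸ hqk) (hgram (N + 1))
  exact ⟨ψ, γ, fun i => by simp [hψ], hγ0, hγ1, fun i j hij => by simp [hψ, hij],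
    hnot N N.lt_succ_self, hyes, hyes, fun M _ hM => hnot M hM⟩

end

end QSE
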